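/- arXiv:2410.04336 — 2 statements merged into one kernel-verified Lean document; each statement's English description precedes it below -/
import Mathlib

section
/- Let H be a complex Hilbert space and let (C_n)_{n∈ℕ} be a decreasing sequence (C_{n+1} ⊆ C_n) of nonempty closed affine subspaces of H. Let u_n denote the unique minimal-norm element of C_n, and suppose there exists B > 0 with ‖u_n‖ ≤ B for all n. Then the sequence (u_n) converges in H to some u_∞ ∈ ⋂_{n∈ℕ} C_n, and ‖u_∞ − u_n‖ → 0 as n → ∞. -/
open Filter Topology

/-- If `x` is no longer than the midpoint of `x` and `y`, then the parallelogram law bounds the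
distance from `x` to `y` by the difference of their squared norms. -/
theorem norm_sub_sq_le_of_norm_le_midpoint {𝕜 E : Type*} [RCLike 𝕜] [SeminormedAddCommGroup E]
    [InnerProductSpace 𝕜 E] {x y : E} (h : ‖x‖ ≤ ‖(2⁻¹ : 𝕜) • (x + y)‖) :
    ‖x - y‖ ^ 2 ≤ 2 * (‖y‖ ^ 2 - ‖x‖ ^ 2) := by
  have hpar := parallelogram_law_with_norm 𝕜 x y
  rw [norm_smul, norm_inv, RCLike.norm_ofNat] at h
  nlinarith [norm_nonneg x, norm_nonneg (x + y)]

/-- A sequence in a metric space is Cauchy if its squared distances are controlled by the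
increments of a bounded monotone real sequence. -/
theorem cauchySeq_of_dist_sq_le_of_monotone {X : Type*} [PseudoMetricSpace X] {u : ℕ → X}
    {a : ℕ → ℝ} (ha : Monotone a) (hbdd : BddAbove (Set.range a))
    (h : ∀ m n, m ≤ n → dist (u m) (u n) ^ 2 ≤ a n - a m) : CauchySeq u := by
  have hcauchy : CauchySeq a := (tendsto_atTop_ciSup ha hbdd).cauchySeq
  rw [Metric.cauchySeq_iff'] at hcauchy ⊢
  intro ε hε
  obtain ⟨N, hN⟩ := hcauchy (ε ^ 2) (by positivity)
  refine ⟨N, fun n hn => ?_⟩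
  have hlt : a n - a N < ε ^ 2 := (le_abs_self _).trans_lt (hN n hn)
  rw [dist_comm]
  exact lt_of_pow_lt_pow_left₀ 2 hε.le ((h N n hn).trans_lt hlt)

/-- For a decreasing sequence of nonempty closed affine subspaces of a Hilbert
space whose minimal-norm elements `u_n` are uniformly bounded, `(u_n)` converges
to some element of the intersection. -/
theorem min_norm_elements_converge
    {H : Type*} [NormedAddCommGroup H] [InnerProductSpace ℂ H] [CompleteSpace H]
    (K : ℕ → Submodule ℂ H) (hK : ∀ n, IsClosed ((K n : Set H)))
    (c : ℕ → H) (C : ℕ → Set H)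
    (hC : ∀ n, C n = {x : H | x - c n ∈ K n})
    (hdec : ∀ n, C (n + 1) ⊆ C n)
    (u : ℕ → H)
    (hmem : ∀ n, u n ∈ C n)
    (hmin : ∀ n, ∀ v ∈ C n, ‖u n‖ ≤ ‖v‖)
    (B : ℝ) (hB : 0 < B) (hbound : ∀ n, ‖u n‖ ≤ B) :
    ∃ uinf : H, uinf ∈ ⋂ n, C n ∧
      Tendsto u atTop (nhds uinf) ∧
      Tendsto (fun n => ‖uinf - u n‖) atTop (nhds 0) := by
  have hanti : Antitone C := antitone_nat_of_succ_le hdec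
  have hclosed : ∀ n, IsClosed (C n) := fun n => by
    rw [hC n]
    exact (hK n).preimage (continuous_id.sub continuous_const)
  have hmid : ∀ n, ∀ x ∈ C n, ∀ y ∈ C n, (2⁻¹ : ℂ) • (x + y) ∈ C n := by
    intro n x hx y hy
    rw [hC n, Set.mem_ofPred_eq] at hx hy ⊢
    have heq : (2⁻¹ : ℂ) • (x + y) - c n = (2⁻¹ : ℂ) • ((x - c n) + (y - c n)) := by
      module
    rw [heq]
    exact (K n).smul_mem _ ((K n).add_mem hx hy)
  have hmono : Monotone fun n => 2 * ‖u n‖ ^ 2 := fun m n hmn => by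
    have hle : ‖u m‖ ≤ ‖u n‖ := hmin m _ (hanti hmn (hmem n))
    dsimp only
    gcongr
  have hcauchy : CauchySeq u := by
    refine cauchySeq_of_dist_sq_le_of_monotone hmono ⟨2 * B ^ 2, ?_⟩ fun m n hmn => ?_
    · rintro _ ⟨n, rfl⟩
      have hle := hbound n
      dsimp only
      gcongr
    · rw [dist_eq_norm, ← mul_sub]
      exact norm_sub_sq_le_of_norm_le_midpoint (𝕜 := ℂ)
        (hmin m _ (hmid m _ (hmem m) _ (hanti hmn (hmem n))))
  obtain ⟨uinf, hlim⟩ := cauchySeq_tendsto_of_complete hcauchy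
  refine ⟨uinf, Set.mem_iInter.2 fun n => ?_, hlim, ?_⟩
  · exact (hclosed n).mem_of_tendsto hlim
      ((eventually_ge_atTop n).mono fun m hnm => hanti hnm (hmem m))
  · simpa using (hlim.const_sub uinf).norm
end

section
/- Let H be a complex Hilbert space, N_S a positive integer, and for each k ∈ {1,…,N_S} let S^k be a topological space and G^k : H → BC(S^k, ℂ) a continuous linear map into the Banach space of bounded continuous complex-valued functions on S^k with the sup norm. Let (x_j)_{j∈ℕ} be a sequence of points with labels k_j ∈ {1,…,N_S} and x_j ∈ S^{k_j}, such that for each k the set {x_j : k_j = k} is dense in S^k. For each k let g^k : S^k → ℂ be continuous, and set f_j := g^{k_j}(x_j). Suppose that for every Ñ ∈ ℕ there exists u^{(Ñ)} ∈ H which satisfies (G^{k_j} u^{(Ñ)})(x_j) = f_j for all j ∈ {1,…,Ñ} and has minimal norm among all elements of H satisfying these Ñ constraints, and suppose there is B > 0 with ‖u^{(Ñ)}‖_H ≤ B for all Ñ. Then there exists u^{(∞)} ∈ H such that (G^k u^{(∞)})(x) = g^k(x) for every k ∈ {1,…,N_S} and every x ∈ S^k, and moreover ‖u^{(∞)} −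 u^{(Ñ)}‖_H → 0 as Ñ → ∞. -/
open Filter Topology

/-- Minimal-norm elements of a decreasing sequence of convex sets form a Cauchy sequence as soon
as their norms are bounded. -/
theorem cauchySeq_of_norm_minimal_of_antitone_convex (𝕜 : Type*) {E : Type*} [RCLike 𝕜]
    [NormedAddCommGroup E] [InnerProductSpace 𝕜 E] [NormedSpace ℝ E] {K : ℕ → Set E}
    (hK : Antitone K) (hconv : ∀ n, Convex ℝ (K n)) {u : ℕ → E} (hu : ∀ n, u n ∈ K n)
    (hmin : ∀ n, ∀ v ∈ K n, ‖u n‖ ≤ ‖v‖) {B : ℝ} (hB : ∀ n, ‖u n‖ ≤ B) : CauchySeq u := by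
  have hmono : Monotone fun n => ‖u n‖ ^ 2 := fun m n hmn =>
    pow_le_pow_left₀ (norm_nonneg _) (hmin m _ (hK hmn (hu n))) 2
  have hbdd : BddAbove (Set.range fun n => ‖u n‖ ^ 2) :=
    ⟨B ^ 2, Set.forall_mem_range.2 fun n => pow_le_pow_left₀ (norm_nonneg _) (hB n) 2⟩
  set L := ⨆ n, ‖u n‖ ^ 2
  have hlim : Tendsto (fun n => ‖u n‖ ^ 2) atTop (𝓝 L) := tendsto_atTop_ciSup hmono hbdd
  have hsq : ∀ m n, m ≤ n → ‖u m - u n‖ ^ 2 ≤ 2 * (L - ‖u m‖ ^ 2) := fun m n hmn => by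
    have hmid : ‖u m‖ ≤ 2⁻¹ * ‖u m + u n‖ := by
      have h := hmin m _ (hconv m (hu m) (hK hmn (hu n)) (a := 2⁻¹) (b := 2⁻¹)
        (by norm_num) (by norm_num) (by norm_num))
      rwa [← smul_add, norm_smul, Real.norm_of_nonneg (by norm_num)] at h
    have hpar := parallelogram_law_with_norm_mul 𝕜 (u m) (u n)
    have hL : ‖u n‖ ^ 2 ≤ L := le_ciSup hbdd n
    nlinarith [norm_nonneg (u m)]
  refine cauchySeq_of_le_tendsto_0' (fun m => √(2 * (L - ‖u m‖ ^ 2))) (fun m n hmn => ?_) ?_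
  · rw [dist_eq_norm]
    exact Real.le_sqrt_of_sq_le (hsq m n hmn)
  · simpa using ((hlim.const_sub L).const_mul 2).sqrt

/-- "Boundedness implies feasibility and convergence": if the minimal-norm
Hermite–Birkhoff interpolants `u^{(Ñ)}` exist and are uniformly bounded in `H`,
then the full PDE system `G^k u = g^k` on `S^k` has a solution `u^{(∞)} ∈ H`,
and `u^{(Ñ)} → u^{(∞)}` in the `H`-norm. -/
theorem boundedness_implies_feasibility_and_convergence
    {H : Type*} [NormedAddCommGroup H] [InnerProductSpace ℂ H] [CompleteSpace H]
    (NS : ℕ) (hNS : 0 < NS)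
    (S : Fin NS → Type*) [∀ k, TopologicalSpace (S k)]
    (G : (k : Fin NS) → (H →L[ℂ] BoundedContinuousFunction (S k) ℂ))
    (p : ℕ → (Σ k : Fin NS, S k))
    (hdense : ∀ k : Fin NS, Dense {y : S k | ∃ j : ℕ, p j = ⟨k, y⟩})
    (g : (k : Fin NS) → S k → ℂ)
    (hgcont : ∀ k, Continuous (g k))
    (f : ℕ → ℂ) (hf : ∀ j, f j = g (p j).1 (p j).2)
    (u : ℕ → H)
    (hsat : ∀ N : ℕ, ∀ j < N, (G (p j).1 (u N)) (p j).2 = f j)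
    (hmin : ∀ N : ℕ, ∀ v : H,
      (∀ j < N, (G (p j).1 v) (p j).2 = f j) → ‖u N‖ ≤ ‖v‖)
    (B : ℝ) (hB : 0 < B) (hbound : ∀ N, ‖u N‖ ≤ B) :
    ∃ uinf : H,
      (∀ k : Fin NS, ∀ y : S k, (G k uinf) y = g k y) ∧
      Tendsto (fun N => ‖uinf - u N‖) atTop (nhds 0) := by
  let K : ℕ → Set H := fun N => {v | ∀ j < N, (G (p j).1 v) (p j).2 = f j}
  have hcauchy : CauchySeq u := by
    refine cauchySeq_of_norm_minimal_of_antitone_convex ℂ (K := K)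
      (fun m n hmn v hv j hj => hv j (hj.trans_le hmn)) (fun n v hv w hw a b _ _ hab j hj => ?_)
      hsat hmin hbound
    have hab' : (a : ℂ) + b = 1 := mod_cast hab
    rw [← Complex.coe_smul, ← Complex.coe_smul, map_add, map_smul, map_smul,
      BoundedContinuousFunction.add_apply, BoundedContinuousFunction.smul_apply,
      BoundedContinuousFunction.smul_apply, hv j hj, hw j hj, ← add_smul, hab', one_smul]
  obtain ⟨uinf, hlim⟩ := cauchySeq_tendsto_of_complete hcauchy
  have hlimit : ∀ j, (G (p j).1 uinf) (p j).2 = f j := fun j => by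
    have hcont : Continuous fun v => (G (p j).1 v) (p j).2 :=
      (continuous_eval_const (p j).2).comp (G (p j).1).continuous
    refine tendsto_nhds_unique ((hcont.tendsto uinf).comp hlim) (tendsto_const_nhds.congr' ?_)
    filter_upwards [eventually_gt_atTop j] with N hN using (hsat N j hN).symm
  refine ⟨uinf, fun k y => ?_, by simpa using (hlim.const_sub uinf).norm⟩
  refine congrFun ((G k uinf).continuous.ext_on (hdense k) (hgcont k) ?_) y
  rintro z ⟨j, hj⟩
  have h := (hlimit j).trans (hf j)
  rwa [hj] at h
end
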